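/- There exists ε > 0 such that for every n and every real p with 0 < p < 1 the following holds: if β ≤ ε·np and G is an n-vertex (p,β)-jumbled simple graph with minimum degree δ(G) ≥ (1−ε)np, then for every partition of the vertex set into disjoint sets A and B with A ∪ B = V(G), the number of edges between A and B satisfies e_G(A,B) ≥ (1−6ε)·p·|A|·|B|. -/

import Mathlib

open SimpleGraph

/-- The number of edges of `G` with both endpoints inside `U`. -/
noncomputable def interiorEdgeCount {V : Type} (G : SimpleGraph V) (U : Set V) : ℕ :=
  {e ∈ G.edgeSet | ∀ v ∈ e, v ∈ U}.ncard

/-- `G` is `(p, β)`-jumbled: `0 < p < 1 ≤ β` and for every vertex subset `U`,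
`|e_G(U) - p * binom(|U|, 2)| ≤ β * |U|`. -/
def IsJumbled {V : Type} (G : SimpleGraph V) (p β : ℝ) : Prop :=
  0 < p ∧ p < 1 ∧ 1 ≤ β ∧
    ∀ U : Set V,
      |(interiorEdgeCount G U : ℝ) - p * (Nat.choose U.ncard 2 : ℕ)| ≤ β * U.ncard

/-- The number of edges in the edge set `E` with one endpoint in `A` and the other in `B`. -/
noncomputable def edgeCountBetween {V : Type} (E : Set (Sym2 V)) (A B : Set V) : ℕ :=
  {e ∈ E | ∃ a ∈ A, ∃ b ∈ B, e = s(a, b)}.ncard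

theorem edgeCountBetween_comm {V : Type} (E : Set (Sym2 V)) (A B : Set V) :
    edgeCountBetween E A B = edgeCountBetween E B A := by
  unfold edgeCountBetween
  congr 1
  ext e
  refine and_congr_right fun _ => ⟨?_, ?_⟩ <;>
    · rintro ⟨a, ha, b, hb, rfl⟩
      exact ⟨b, hb, a, ha, Sym2.eq_swap⟩

open Classical in
theorem card_adj_within_le {V : Type} [Fintype V] (G : SimpleGraph V) (A : Set V) :
    (Finset.univ.filter fun q : V × V => (G.Adj q.1 q.2 ∧ q.1 ∈ A) ∧ q.2 ∈ A).card ≤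
      2 * interiorEdgeCount G A := by
  unfold interiorEdgeCount
  rw [Set.ncard_eq_toFinset_card']
  refine Finset.card_le_mul_card_image_of_maps_to (f := fun q : V × V => s(q.1, q.2)) ?_ 2 ?_
  · rintro ⟨x, y⟩ h
    simp_all
  · intro e _
    induction e using Sym2.ind with
    | _ x y =>
      refine (Finset.card_le_card (t := {(x, y), (y, x)}) ?_).trans Finset.card_le_two
      rintro ⟨u, v⟩ h
      simpa using (Finset.mem_filter.1 h).2

open Classical in
theorem card_adj_across_le {V : Type} [Fintype V] (G : SimpleGraph V) {A B : Set V}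
    (hAB : Disjoint A B) :
    (Finset.univ.filter fun q : V × V => G.Adj q.1 q.2 ∧ q.1 ∈ A ∧ q.2 ∈ B).card ≤
      edgeCountBetween G.edgeSet A B := by
  unfold edgeCountBetween
  rw [Set.ncard_eq_toFinset_card']
  refine Finset.card_le_card_of_injOn (fun q : V × V => s(q.1, q.2)) ?_ ?_
  · rintro ⟨x, y⟩ h
    simp only [Finset.coe_filter, Finset.mem_univ, true_and, Set.mem_ofPred_eq] at h
    simp only [Set.coe_toFinset, Set.mem_ofPred_eq, SimpleGraph.mem_edgeSet]
    exact ⟨h.1, x, h.2.1, y, h.2.2, rfl⟩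
  · rintro ⟨x, y⟩ h ⟨u, v⟩ h' heq
    simp only [Finset.coe_filter, Finset.mem_univ, true_and, Set.mem_ofPred_eq] at h h'
    rcases Sym2.eq_iff.1 heq with ⟨rfl, rfl⟩ | ⟨rfl, rfl⟩
    · rfl
    · exact (Set.disjoint_left.1 hAB h.2.1 h'.2.2).elim

open Classical in
theorem sum_ncard_neighborSet_le {V : Type} [Fintype V] (G : SimpleGraph V) {A B : Set V}
    (hAB : Disjoint A B) (hU : A ∪ B = Set.univ) :
    ∑ v ∈ A.toFinset, (G.neighborSet v).ncard ≤
      2 * interiorEdgeCount G A + edgeCountBetween G.edgeSet A B := by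
  have hsum : ∑ v ∈ A.toFinset, (G.neighborSet v).ncard =
      (Finset.univ.filter fun q : V × V => G.Adj q.1 q.2 ∧ q.1 ∈ A).card := by
    rw [Finset.card_eq_sum_card_fiberwise (f := Prod.fst) (t := A.toFinset)
      (by intro q hq; simp_all)]
    refine Finset.sum_congr rfl fun v hv => ?_
    rw [Set.ncard_eq_toFinset_card', ← Finset.card_map ⟨Prod.mk v, Prod.mk_right_injective v⟩]
    congr 1
    ext ⟨x, y⟩
    have hvA : v ∈ A := by simpa using hv
    simp only [Finset.mem_map, Finset.mem_filter, Set.mem_toFinset,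
      SimpleGraph.mem_neighborSet, Function.Embedding.coeFn_mk, Prod.mk.injEq, Finset.mem_univ,
      true_and]
    constructor
    · rintro ⟨w, hw, rfl, rfl⟩
      exact ⟨⟨hw, hvA⟩, rfl⟩
    · rintro ⟨⟨hxy, _⟩, rfl⟩
      exact ⟨y, hxy, rfl, rfl⟩
  rw [hsum, ← Finset.card_filter_add_card_filter_not (fun q : V × V => q.2 ∈ A),
    Finset.filter_filter, Finset.filter_filter]
  refine add_le_add (card_adj_within_le G A) (le_trans (Finset.card_le_card ?_)
    (card_adj_across_le G hAB))
  intro q hq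
  simp only [Finset.mem_filter, Finset.mem_univ, true_and] at hq ⊢
  have hq2 : q.2 ∈ A ∪ B := hU ▸ Set.mem_univ _
  exact ⟨hq.1.1, hq.1.2, hq2.resolve_left hq.2⟩

/-- The cut bound across a partition whose first part is the smaller one. -/
theorem IsJumbled.le_edgeCountBetween_of_ncard_le {V : Type} [Fintype V] {G : SimpleGraph V}
    {p β ε : ℝ} (hε : 0 ≤ ε) (hG : IsJumbled G p β) (hβ : β ≤ ε * Fintype.card V * p)
    (hδ : ∀ v : V, (1 - ε) * Fintype.card V * p ≤ (G.neighborSet v).ncard)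
    {A B : Set V} (hAB : Disjoint A B) (hU : A ∪ B = Set.univ) (hle : A.ncard ≤ B.ncard) :
    (1 - 6 * ε) * p * A.ncard * B.ncard ≤ edgeCountBetween G.edgeSet A B := by
  classical
  obtain ⟨hp, -, -, hJ⟩ := hG
  have hn : (Fintype.card V : ℝ) = A.ncard + B.ncard := by
    rw [← Nat.card_eq_fintype_card, ← Set.ncard_univ, ← hU, Set.ncard_union_eq hAB]
    push_cast
    rfl
  have hdeg : (A.ncard : ℝ) * ((1 - ε) * Fintype.card V * p) ≤
      2 * interiorEdgeCount G A + edgeCountBetween G.edgeSet A B := by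
    have hcount : ((∑ v ∈ A.toFinset, (G.neighborSet v).ncard : ℕ) : ℝ) ≤
        2 * interiorEdgeCount G A + edgeCountBetween G.edgeSet A B := by
      exact_mod_cast sum_ncard_neighborSet_le G hAB hU
    refine le_trans ?_ hcount
    rw [Set.ncard_eq_toFinset_card', ← nsmul_eq_mul]
    push_cast
    exact Finset.card_nsmul_le_sum _ _ _ fun v _ => hδ v
  have hint := (abs_le.1 (hJ A)).2
  rw [Nat.cast_choose_two] at hint
  rw [hn] at hdeg hβ
  have hle' : (A.ncard : ℝ) ≤ B.ncard := by exact_mod_cast hle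
  have ha : (0 : ℝ) ≤ A.ncard := Nat.cast_nonneg _
  generalize (A.ncard : ℝ) = a at *
  generalize (B.ncard : ℝ) = b at *
  have hβa : β * a ≤ ε * (a + b) * p * a := mul_le_mul_of_nonneg_right hβ ha
  have hpa : 0 ≤ p * a := by positivity
  have hslack : 0 ≤ ε * (p * a) * (b - a) := mul_nonneg (by positivity) (by linarith)
  linarith

/-- In a jumbled graph with large minimum degree every cut has nearly the expected size. -/
theorem IsJumbled.le_edgeCountBetween {V : Type} [Fintype V] {G : SimpleGraph V}
    {p β ε : ℝ} (hε : 0 ≤ ε) (hG : IsJumbled G p β) (hβ : β ≤ ε * Fintype.card V * p)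
    (hδ : ∀ v : V, (1 - ε) * Fintype.card V * p ≤ (G.neighborSet v).ncard)
    {A B : Set V} (hAB : Disjoint A B) (hU : A ∪ B = Set.univ) :
    (1 - 6 * ε) * p * A.ncard * B.ncard ≤ edgeCountBetween G.edgeSet A B := by
  rcases le_total A.ncard B.ncard with h | h
  · exact hG.le_edgeCountBetween_of_ncard_le hε hβ hδ hAB hU h
  · rw [edgeCountBetween_comm, mul_right_comm]
    exact hG.le_edgeCountBetween_of_ncard_le hε hβ hδ hAB.symm (Set.union_comm A B ▸ hU) h

theorem jumbled_cut_lower_bound :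
    ∃ ε : ℝ, ε > 0 ∧ ∀ (n : ℕ) (p : ℝ), 0 < p → p < 1 →
      ∀ (V : Type) [Fintype V] [DecidableEq V] (G : SimpleGraph V) (β : ℝ),
        Fintype.card V = n →
        β ≤ ε * n * p →
        IsJumbled G p β →
        (∀ v : V, ((G.neighborSet v).ncard : ℝ) ≥ (1 - ε) * n * p) →
        ∀ A B : Set V, Disjoint A B → A ∪ B = Set.univ →
          (edgeCountBetween G.edgeSet A B : ℝ) ≥ (1 - 6 * ε) * p * A.ncard * B.ncard := by
  refine ⟨1 / 12, by norm_num, ?_⟩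
  rintro n p - - V _ _ G β rfl hβ hG hδ A B hAB hU
  exact hG.le_edgeCountBetween (by norm_num) hβ hδ hAB hU
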